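/- (Packing bound) Let r > 0, let 0 < λ_p < λ_c < 1 be scale factors, and set α = (3+λ_c)/(1−λ_c). Let Y ⊆ ℝᵈ be a set of points such that the capsules C^{λ_p}(y, r), for y ∈ Y, are pairwise disjoint. Then for any x ∈ ℝᵈ and any β ≥ 1, the set {y ∈ Y : C^{λ_c}(y, r) ∩ C^{λ_c}(x, β·r) ≠ ∅} is finite and its cardinality is at most (α²·λ_c·β / λ_p)ᵈ. -/

import Mathlib

noncomputable section

open Metric Set MeasureTheory
open scoped InnerProductSpace Classical

variable {d n : ℕ}

/-- The capsule `C_s(x,r)` induced by a single segment `s = [a,b]` with unit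
direction vector `v`.  If the nearest point of `s` to `x` is an endpoint, it is
the closed ball of radius `max r (dist x s)`; otherwise it is the intersection
of the infinite closed cylinder of radius `max r (dist x s)` whose axis is the
line through `x` parallel to `v` with the closed ball of radius
`max r (min ‖x-a‖ ‖x-b‖)`. -/
def capsuleSeg (a b v x : EuclideanSpace ℝ (Fin d)) (r : ℝ) :
    Set (EuclideanSpace ℝ (Fin d)) :=
  if Metric.infDist x (segment ℝ a b) = min (dist x a) (dist x b) then
    Metric.closedBall x (max r (Metric.infDist x (segment ℝ a b)))
  else
    {y | ‖(y - x) - ⟪y - x, v⟫_ℝ • v‖ ≤ max r (Metric.infDist x (segment ℝ a b))} ∩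
      Metric.closedBall x (max r (min (dist x a) (dist x b)))

/-- The capsule `C(x,r)` of the family of segments `s i = [a i, b i]`. -/
def capsuleFam (a b v : Fin n → EuclideanSpace ℝ (Fin d))
    (x : EuclideanSpace ℝ (Fin d)) (r : ℝ) : Set (EuclideanSpace ℝ (Fin d)) :=
  ⋂ i, capsuleSeg (a i) (b i) (v i) x r

/-- Image of a set under the homothety (central scaling) centered at `x` with ratio `lam`. -/
def scaleAbout (x : EuclideanSpace ℝ (Fin d)) (lam : ℝ)
    (C : Set (EuclideanSpace ℝ (Fin d))) : Set (EuclideanSpace ℝ (Fin d)) :=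
  (AffineMap.homothety x lam) '' C

/-- Local feature size: the distance from `x` to its second-nearest segment. -/
def lfs (a b : Fin n → EuclideanSpace ℝ (Fin d)) (x : EuclideanSpace ℝ (Fin d)) : ℝ :=
  sInf {t | ∃ i j : Fin n, i < j ∧
    t = max (Metric.infDist x (segment ℝ (a i) (b i)))
            (Metric.infDist x (segment ℝ (a j) (b j)))}

/-- `D_i(x)`: half the squared distance from `x` to the segment `[a,b]`. -/
def Dseg (a b x : EuclideanSpace ℝ (Fin d)) : ℝ :=
  Metric.infDist x (segment ℝ a b) ^ 2 / 2

/-- `D•_i(x)`: half the squared distance from `x` to the nearest endpoint. -/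
def Dbullet (a b x : EuclideanSpace ℝ (Fin d)) : ℝ :=
  min (dist x a ^ 2) (dist x b ^ 2) / 2

/-- The quadratic form `w ↦ wᵀ H_i(x) w` of the local tensor
`H_i(x) = (1/D_i(x))(I - v vᵀ) + (1/D•_i(x)) v vᵀ`. -/
def tensorQ (a b v x w : EuclideanSpace ℝ (Fin d)) : ℝ :=
  (1 / Dseg a b x) * (‖w‖ ^ 2 - ⟪w, v⟫_ℝ ^ 2) + (1 / Dbullet a b x) * ⟪w, v⟫_ℝ ^ 2

/-- The local ellipsoid `E_i(x) = {y | ½ (y-x)ᵀ H_i(x) (y-x) ≤ 1}`. -/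
def localEllipsoid (a b v x : EuclideanSpace ℝ (Fin d)) :
    Set (EuclideanSpace ℝ (Fin d)) :=
  {y | tensorQ a b v x (y - x) / 2 ≤ 1}

/-- `Ê(x)`: the intersection of the local ellipsoids of all segments. -/
def hatE (a b v : Fin n → EuclideanSpace ℝ (Fin d)) (x : EuclideanSpace ℝ (Fin d)) :
    Set (EuclideanSpace ℝ (Fin d)) :=
  ⋂ i, localEllipsoid (a i) (b i) (v i) x

/-- `Ẽ(x)`: the ellipsoid of the blended tensor `H(x) = ∑ i, H_i(x)`. -/
def tildeE (a b v : Fin n → EuclideanSpace ℝ (Fin d)) (x : EuclideanSpace ℝ (Fin d)) :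
    Set (EuclideanSpace ℝ (Fin d)) :=
  {y | (∑ i, tensorQ (a i) (b i) (v i) x (y - x)) / 2 ≤ 1}

/-- Projection orthogonal to `v`. -/
def prj (v w : EuclideanSpace ℝ (Fin d)) : EuclideanSpace ℝ (Fin d) := w - ⟪w, v⟫_ℝ • v

lemma prj_add (v w z : EuclideanSpace ℝ (Fin d)) : prj v (w + z) = prj v w + prj v z := by
  simp only [prj, inner_add_left, add_smul]; abel

lemma prj_smul (v w : EuclideanSpace ℝ (Fin d)) (c : ℝ) : prj v (c • w) = c • prj v w := by
  simp only [prj, real_inner_smul_left, smul_sub, smul_smul]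

lemma prj_self (v : EuclideanSpace ℝ (Fin d)) (hv : ‖v‖ = 1) : prj v v = 0 := by
  simp [prj, hv]

lemma norm_prj_sq (v w : EuclideanSpace ℝ (Fin d)) (hv : ‖v‖ = 1) :
    ‖prj v w‖ ^ 2 = ‖w‖ ^ 2 - ⟪w, v⟫_ℝ ^ 2 := by
  rw [prj, norm_sub_sq_real, norm_smul, hv, real_inner_smul_right, mul_one, Real.norm_eq_abs,
    sq_abs]
  ring

lemma norm_prj_le (v w : EuclideanSpace ℝ (Fin d)) (hv : ‖v‖ = 1) : ‖prj v w‖ ≤ ‖w‖ := by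
  have := norm_prj_sq v w hv
  apply le_of_sq_le_sq _ (norm_nonneg _)
  nlinarith [sq_nonneg ⟪w, v⟫_ℝ]

lemma seg_param {a b v q : EuclideanSpace ℝ (Fin d)} {L : ℝ} (hL : 0 < L)
    (hdir : b - a = L • v) : q ∈ segment ℝ a b ↔ ∃ t : ℝ, 0 ≤ t ∧ t ≤ L ∧ q = a + t • v := by
  rw [segment_eq_image']
  constructor
  · rintro ⟨t, ⟨h0, h1⟩, rfl⟩
    refine ⟨t * L, by positivity, by nlinarith, ?_⟩
    simp only [hdir, smul_smul]
  · rintro ⟨t, h0, h1, rfl⟩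
    refine ⟨t / L, ⟨by positivity, by rw [div_le_one hL]; exact h1⟩, ?_⟩
    simp only [hdir, smul_smul, div_mul_cancel₀ _ hL.ne']

lemma line_le {a b v : EuclideanSpace ℝ (Fin d)} {L : ℝ} (hL : 0 < L) (hv : ‖v‖ = 1)
    (hdir : b - a = L • v) (p : EuclideanSpace ℝ (Fin d)) :
    ‖prj v (p - a)‖ ≤ Metric.infDist p (segment ℝ a b) := by
  rw [Metric.le_infDist ⟨a, left_mem_segment ℝ a b⟩]
  intro q hq
  obtain ⟨t, -, -, rfl⟩ := (seg_param hL hdir).1 hq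
  have : p - a = (p - (a + t • v)) + t • v := by abel
  rw [this, prj_add, prj_smul, prj_self v hv, smul_zero, add_zero, dist_eq_norm]
  exact norm_prj_le _ _ hv

lemma infDist_le_prj {a b v : EuclideanSpace ℝ (Fin d)} {L : ℝ} (hL : 0 < L)
    (hdir : b - a = L • v) (p : EuclideanSpace ℝ (Fin d))
    (h0 : 0 ≤ ⟪p - a, v⟫_ℝ) (h1 : ⟪p - a, v⟫_ℝ ≤ L) :
    Metric.infDist p (segment ℝ a b) ≤ ‖prj v (p - a)‖ := by
  have hm := (seg_param (q := a + ⟪p - a, v⟫_ℝ • v) hL hdir).2 ⟨_, h0, h1, rfl⟩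
  refine (Metric.infDist_le_dist_of_mem hm).trans (le_of_eq ?_)
  rw [dist_eq_norm, prj, sub_add_eq_sub_sub]

lemma infDist_le_min (a b x : EuclideanSpace ℝ (Fin d)) :
    Metric.infDist x (segment ℝ a b) ≤ min (dist x a) (dist x b) :=
  le_min (Metric.infDist_le_dist_of_mem (left_mem_segment ℝ a b))
    (Metric.infDist_le_dist_of_mem (right_mem_segment ℝ a b))

lemma dist_ray {a v x : EuclideanSpace ℝ (Fin d)} {t : ℝ} (ht : 0 ≤ t)
    (hx : ⟪x - a, v⟫_ℝ ≤ 0) : dist x a ≤ dist x (a + t • v) := by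
  rw [dist_eq_norm, dist_eq_norm, sub_add_eq_sub_sub]
  apply le_of_sq_le_sq _ (norm_nonneg _)
  rw [norm_sub_sq_real (x - a), real_inner_smul_right]
  nlinarith [sq_nonneg ‖t • v‖, mul_nonneg ht (neg_nonneg.2 hx)]

lemma dichotomy {a b v : EuclideanSpace ℝ (Fin d)} {L : ℝ} (hL : 0 < L) (hv : ‖v‖ = 1)
    (hdir : b - a = L • v) (x : EuclideanSpace ℝ (Fin d)) :
    Metric.infDist x (segment ℝ a b) = min (dist x a) (dist x b) ∨
    (0 ≤ ⟪x - a, v⟫_ℝ ∧ ⟪x - a, v⟫_ℝ ≤ L ∧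
      Metric.infDist x (segment ℝ a b) = ‖prj v (x - a)‖) := by
  have hb : b = a + L • v := by rw [← hdir]; abel
  have hne : (segment ℝ a b).Nonempty := ⟨a, left_mem_segment ℝ a b⟩
  rcases le_total ⟪x - a, v⟫_ℝ 0 with h0 | h0
  · left
    refine le_antisymm (infDist_le_min a b x) ((min_le_left _ _).trans ?_)
    rw [Metric.le_infDist hne]
    intro q hq
    obtain ⟨t, ht, -, rfl⟩ := (seg_param hL hdir).1 hq
    exact dist_ray ht h0
  rcases le_total ⟪x - a, v⟫_ℝ L with h1 | h1
  · right
    exact ⟨h0, h1, le_antisymm (infDist_le_prj hL hdir x h0 h1) (line_le hL hv hdir x)⟩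
  · left
    refine le_antisymm (infDist_le_min a b x) ((min_le_right _ _).trans ?_)
    rw [Metric.le_infDist hne]
    intro q hq
    obtain ⟨t, ht, htL, rfl⟩ := (seg_param hL hdir).1 hq
    have : a + t • v = b + (L - t) • (-v) := by rw [hb, sub_smul]; simp only [smul_neg]; abel
    rw [this]
    apply dist_ray (by linarith)
    rw [inner_neg_right, hb, sub_add_eq_sub_sub, inner_sub_left, real_inner_smul_left,
      real_inner_self_eq_norm_sq, hv]
    linarith

/-- the two radii -/
def rR (a b x : EuclideanSpace ℝ (Fin d)) (r : ℝ) : ℝ := max r (Metric.infDist x (segment ℝ a b))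
/-- the two radii -/
def rQ (a b x : EuclideanSpace ℝ (Fin d)) (r : ℝ) : ℝ := max r (min (dist x a) (dist x b))

lemma mem_capsuleSeg {a b v : EuclideanSpace ℝ (Fin d)} (hv : ‖v‖ = 1)
    (x p : EuclideanSpace ℝ (Fin d)) (r : ℝ) :
    p ∈ capsuleSeg a b v x r ↔ ‖prj v (p - x)‖ ≤ rR a b x r ∧ ‖p - x‖ ≤ rQ a b x r := by
  unfold capsuleSeg
  split_ifs with h
  · rw [Metric.mem_closedBall, dist_eq_norm, rR, rQ, ← h]
    exact ⟨fun hp => ⟨(norm_prj_le _ _ hv).trans hp, hp⟩, fun hp => hp.2⟩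
  · simp only [Set.mem_inter_iff, Set.mem_ofPred_eq, Metric.mem_closedBall, dist_eq_norm, rR, rQ,
      prj]

lemma end_bound {e u x p : EuclideanSpace ℝ (Fin d)} (hu : ‖u‖ = 1)
    (h : ‖p - x‖ ≤ ‖x - e‖) (hx : 0 ≤ ⟪x - e, u⟫_ℝ) (hp : ⟪p - e, u⟫_ℝ ≤ 0) :
    ‖p - e‖ ≤ 2 * ‖prj u (x - e)‖ := by
  have h1 : ‖(p - x) + ⟪x - e, u⟫_ℝ • u‖ ≤ ‖prj u (x - e)‖ := by
    apply le_of_sq_le_sq _ (norm_nonneg _)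
    have h2 : ⟪p - x, u⟫_ℝ = ⟪p - e, u⟫_ℝ - ⟪x - e, u⟫_ℝ := by
      rw [← inner_sub_left]; congr 1; abel
    rw [norm_prj_sq _ _ hu, norm_add_sq_real, norm_smul, hu, real_inner_smul_right, mul_one,
      Real.norm_eq_abs, sq_abs, h2]
    have := pow_le_pow_left₀ (norm_nonneg _) h 2
    nlinarith [mul_nonneg hx (neg_nonneg.2 hp)]
  have h3 : p - e = ((p - x) + ⟪x - e, u⟫_ℝ • u) + prj u (x - e) := by
    rw [prj]; abel
  rw [h3]
  refine (norm_add_le _ _).trans ?_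
  linarith

lemma far_bound {a b v : EuclideanSpace ℝ (Fin d)} {L : ℝ} (hL : 0 < L) (hv : ‖v‖ = 1)
    (hdir : b - a = L • v) (x p : EuclideanSpace ℝ (Fin d)) (r : ℝ)
    (h1 : ‖prj v (p - x)‖ ≤ rR a b x r) (h2 : ‖p - x‖ ≤ rQ a b x r) :
    Metric.infDist p (segment ℝ a b) ≤ 2 * rR a b x r := by
  have hb : b = a + L • v := by rw [← hdir]; abel
  have hlip : Metric.infDist p (segment ℝ a b) ≤
    Metric.infDist x (segment ℝ a b) + ‖p - x‖ := by
    rw [← dist_eq_norm]; exact Metric.infDist_le_infDist_add_dist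
  have hR1 : r ≤ rR a b x r := le_max_left _ _
  have hR2 : Metric.infDist x (segment ℝ a b) ≤ rR a b x r := le_max_right _ _
  rcases dichotomy hL hv hdir x with h | ⟨ha, hb', h⟩
  · have : rR a b x r = rQ a b x r := by rw [rR, rQ, h]
    linarith
  by_cases hr : ‖p - x‖ ≤ r
  · linarith
  have h3 : ‖p - x‖ ≤ min (dist x a) (dist x b) := by
    rcases le_max_iff.1 h2 with h4 | h4
    · exact absurd h4 hr
    · exact h4
  rw [h] at hR2
  rcases le_total ⟪p - a, v⟫_ℝ 0 with h0 | h0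
  · have := end_bound hv (h3.trans (by rw [← dist_eq_norm]; exact min_le_left _ _)) ha h0
    have h5 := Metric.infDist_le_dist_of_mem (x := p) (left_mem_segment ℝ a b)
    rw [dist_eq_norm] at h5
    linarith
  have e : ∀ z, ⟪z - b, -v⟫_ℝ = L - ⟪z - a, v⟫_ℝ := by
    intro z
    rw [inner_neg_right, hb, sub_add_eq_sub_sub, inner_sub_left, real_inner_smul_left,
      real_inner_self_eq_norm_sq, hv]
    ring
  rcases le_total ⟪p - a, v⟫_ℝ L with h1' | h1'
  · refine (infDist_le_prj hL hdir p h0 h1').trans ?_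
    have : p - a = (p - x) + (x - a) := by abel
    rw [this, prj_add]
    refine (norm_add_le _ _).trans ?_
    linarith
  · have := end_bound (e := b) (u := -v) (x := x) (p := p) (by rw [norm_neg, hv])
      (h3.trans (by rw [← dist_eq_norm]; exact min_le_right _ _))
      (by rw [e]; linarith) (by rw [e]; linarith)
    have h6 : prj (-v) (x - b) = prj v (x - a) := by
      have : x - a = (x - b) + L • v := by rw [hb]; abel
      rw [this, prj_add, prj_smul, prj_self v hv]
      simp [prj]
    rw [h6] at this
    have h5 := Metric.infDist_le_dist_of_mem (x := p) (right_mem_segment ℝ a b)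
    rw [dist_eq_norm] at h5
    linarith

lemma far_bound_scaled {a b v : EuclideanSpace ℝ (Fin d)} {L : ℝ} (hL : 0 < L) (hv : ‖v‖ = 1)
    (hdir : b - a = L • v) (x p : EuclideanSpace ℝ (Fin d)) (r lam : ℝ) (h0 : 0 < lam)
    (hl1 : lam < 1)
    (h1 : ‖prj v (p - x)‖ ≤ lam * rR a b x r) (h2 : ‖p - x‖ ≤ lam * rQ a b x r) :
    Metric.infDist p (segment ℝ a b) ≤ (1 + lam) * rR a b x r := by
  set p' := x + lam⁻¹ • (p - x) with hp'
  have e : p' - x = lam⁻¹ • (p - x) := by rw [hp']; abel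
  have f1 : Metric.infDist p' (segment ℝ a b) ≤ 2 * rR a b x r := by
    apply far_bound hL hv hdir
    · rw [e, prj_smul, norm_smul, Real.norm_eq_abs, abs_of_pos (by positivity),
        inv_mul_le_iff₀ h0]; exact h1
    · rw [e, norm_smul, Real.norm_eq_abs, abs_of_pos (by positivity),
        inv_mul_le_iff₀ h0]; exact h2
  have hc : IsCompact (segment ℝ a b) := by
    rw [segment_eq_image_lineMap]
    exact isCompact_Icc.image AffineMap.lineMap_continuous
  have hne : (segment ℝ a b).Nonempty := ⟨a, left_mem_segment ℝ a b⟩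
  obtain ⟨q, hq, hq'⟩ := hc.exists_infDist_eq_dist hne x
  obtain ⟨q1, hq1, hq1'⟩ := hc.exists_infDist_eq_dist hne p'
  have hm : (1 - lam) • q + lam • q1 ∈ segment ℝ a b :=
    convex_segment a b hq hq1 (by linarith) h0.le (by ring)
  refine (Metric.infDist_le_dist_of_mem hm).trans ?_
  have ee : p - ((1 - lam) • q + lam • q1) = (1 - lam) • (x - q) + lam • (p' - q1) := by
    rw [hp', smul_sub, smul_sub, smul_add, smul_smul, mul_inv_cancel₀ h0.ne', one_smul, sub_smul,
      one_smul, sub_smul, one_smul]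
    abel
  have hR2 : Metric.infDist x (segment ℝ a b) ≤ rR a b x r := le_max_right _ _
  rw [dist_eq_norm, ee]
  refine (norm_add_le _ _).trans ?_
  rw [norm_smul, norm_smul, ← dist_eq_norm x q, ← dist_eq_norm p' q1, ← hq', ← hq1', Real.norm_eq_abs,
    Real.norm_eq_abs, abs_of_pos h0, abs_of_pos (by linarith : 0 < 1 - lam)]
  nlinarith

lemma near_bound {a b v : EuclideanSpace ℝ (Fin d)} {L : ℝ} (hL : 0 < L) (hv : ‖v‖ = 1)
    (hdir : b - a = L • v) (y p : EuclideanSpace ℝ (Fin d)) (r lam : ℝ)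
    (h1 : ‖prj v (p - y)‖ ≤ lam * rR a b y r) (h2 : ‖p - y‖ ≤ lam * rQ a b y r) :
    Metric.infDist y (segment ℝ a b) ≤ Metric.infDist p (segment ℝ a b) + lam * rR a b y r := by
  rcases dichotomy hL hv hdir y with h | ⟨ha, hb', h⟩
  · have : rR a b y r = rQ a b y r := by rw [rR, rQ, h]
    rw [this]
    refine (Metric.infDist_le_infDist_add_dist (y := p)).trans ?_
    rw [dist_comm, dist_eq_norm]; linarith
  · rw [h]
    have := line_le hL hv hdir p
    have e : y - a = (p - a) + (-1 : ℝ) • (p - y) := by rw [neg_one_smul]; abel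
    rw [e, prj_add, prj_smul]
    refine (norm_add_le _ _).trans ?_
    rw [norm_smul]
    norm_num
    linarith

lemma R_compare {a b v : EuclideanSpace ℝ (Fin d)} {L : ℝ} (hL : 0 < L) (hv : ‖v‖ = 1)
    (hdir : b - a = L • v) (x y p : EuclideanSpace ℝ (Fin d)) (r lam : ℝ) (hr : 0 < r)
    (h0 : 0 < lam) (hl1 : lam < 1)
    (h1 : ‖prj v (p - x)‖ ≤ lam * rR a b x r) (h2 : ‖p - x‖ ≤ lam * rQ a b x r)
    (h3 : ‖prj v (p - y)‖ ≤ lam * rR a b y r) (h4 : ‖p - y‖ ≤ lam * rQ a b y r) :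
    (1 - lam) * rR a b y r ≤ (1 + lam) * rR a b x r := by
  have f := far_bound_scaled hL hv hdir x p r lam h0 hl1 h1 h2
  have g := near_bound hL hv hdir y p r lam h3 h4
  have hR1 : r ≤ rR a b x r := le_max_left _ _
  rcases max_cases r (Metric.infDist y (segment ℝ a b)) with ⟨h, -⟩ | ⟨h, -⟩
  · rw [show rR a b y r = r from h]; nlinarith
  · rw [← show rR a b y r = Metric.infDist y (segment ℝ a b) from h] at g
    linarith

lemma Q_compare (a b x y p : EuclideanSpace ℝ (Fin d)) (r lam : ℝ)
    (h2 : ‖p - x‖ ≤ lam * rQ a b x r) (h4 : ‖p - y‖ ≤ lam * rQ a b y r) :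
    (1 - lam) * rQ a b y r ≤ (1 + lam) * rQ a b x r := by
  have hd : dist y x ≤ ‖p - x‖ + ‖p - y‖ := by
    rw [← dist_eq_norm, ← dist_eq_norm, add_comm, dist_comm p y]; exact dist_triangle _ _ _
  have : rQ a b y r ≤ rQ a b x r + dist y x := by
    have h1 := dist_triangle y x a
    have h3 := dist_triangle y x b
    have := dist_nonneg (x := y) (y := x)
    unfold rQ
    rw [max_add, min_add]
    apply max_le_max (by linarith)
    apply min_le_min <;> linarith
  linarith

/-- centred scaled capsule -/
def KK (a b v : Fin n → EuclideanSpace ℝ (Fin d)) (x : EuclideanSpace ℝ (Fin d)) (r lam : ℝ) :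
    Set (EuclideanSpace ℝ (Fin d)) :=
  {w | ∀ i, ‖prj (v i) w‖ ≤ lam * rR (a i) (b i) x r ∧ ‖w‖ ≤ lam * rQ (a i) (b i) x r}

lemma mem_scale (a b v : Fin n → EuclideanSpace ℝ (Fin d)) (hv : ∀ i, ‖v i‖ = 1)
    (x p : EuclideanSpace ℝ (Fin d)) (r lam : ℝ) (h0 : 0 < lam) :
    p ∈ scaleAbout x lam (capsuleFam a b v x r) ↔ p - x ∈ KK a b v x r lam := by
  simp only [scaleAbout, capsuleFam, Set.mem_image, Set.mem_iInter, KK, Set.mem_ofPred_eq]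
  constructor
  · rintro ⟨q, hq, rfl⟩ i
    have := (mem_capsuleSeg (hv i) x q r).1 (hq i)
    have e : AffineMap.homothety x lam q - x = lam • (q - x) := by
      simp [AffineMap.homothety_apply]
    rw [e, prj_smul, norm_smul, norm_smul, Real.norm_eq_abs, abs_of_pos h0]
    exact ⟨mul_le_mul_of_nonneg_left this.1 h0.le, mul_le_mul_of_nonneg_left this.2 h0.le⟩
  · intro h
    refine ⟨x + lam⁻¹ • (p - x), fun i => ?_, ?_⟩
    · rw [mem_capsuleSeg (hv i), add_sub_cancel_left, prj_smul, norm_smul, norm_smul,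
        Real.norm_eq_abs, abs_of_pos (by positivity), inv_mul_le_iff₀ h0, inv_mul_le_iff₀ h0]
      exact h i
    · simp [AffineMap.homothety_apply, smul_smul, h0.ne']

lemma KK_smul (a b v : Fin n → EuclideanSpace ℝ (Fin d)) (x : EuclideanSpace ℝ (Fin d))
    (r lam c : ℝ) (hc : 0 < c) : KK a b v x r (c * lam) = (fun w => c • w) '' KK a b v x r lam := by
  ext w
  simp only [KK, Set.mem_image, Set.mem_ofPred_eq]
  constructor
  · intro h
    refine ⟨c⁻¹ • w, fun i => ?_, by simp [smul_smul, hc.ne']⟩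
    rw [prj_smul, norm_smul, norm_smul, Real.norm_eq_abs, abs_of_pos (by positivity),
      inv_mul_le_iff₀ hc, inv_mul_le_iff₀ hc, ← mul_assoc, ← mul_assoc]
    exact h i
  · rintro ⟨u, h, rfl⟩ i
    rw [prj_smul, norm_smul, norm_smul, Real.norm_eq_abs, abs_of_pos hc, mul_assoc, mul_assoc]
    exact ⟨mul_le_mul_of_nonneg_left (h i).1 hc.le, mul_le_mul_of_nonneg_left (h i).2 hc.le⟩

lemma KK_vol_smul (a b v : Fin n → EuclideanSpace ℝ (Fin d)) (x : EuclideanSpace ℝ (Fin d))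
    (r lam c : ℝ) (hc : 0 < c) :
    volume.real (KK a b v x r (c * lam)) = c ^ d * volume.real (KK a b v x r lam) := by
  rw [KK_smul _ _ _ _ _ _ _ hc, Set.image_smul, Measure.real, Measure.addHaar_smul,
    ENNReal.toReal_mul, finrank_euclideanSpace_fin, ENNReal.toReal_ofReal (by positivity),
    abs_of_pos (by positivity), Measure.real]

lemma KK_closed (a b v : Fin n → EuclideanSpace ℝ (Fin d)) (x : EuclideanSpace ℝ (Fin d))
    (r lam : ℝ) : IsClosed (KK a b v x r lam) := by
  have h : KK a b v x r lam = ⋂ i, ({w | ‖prj (v i) w‖ ≤ lam * rR (a i) (b i) x r} ∩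
      {w | ‖w‖ ≤ lam * rQ (a i) (b i) x r}) := by
    ext w; simp [KK]
  rw [h]
  refine isClosed_iInter fun i => IsClosed.inter ?_ (isClosed_le continuous_norm continuous_const)
  refine isClosed_le ?_ continuous_const
  unfold prj
  fun_prop

lemma KK_sub_ball (hn : 1 ≤ n) (a b v : Fin n → EuclideanSpace ℝ (Fin d))
    (x : EuclideanSpace ℝ (Fin d)) (r lam : ℝ) :
    KK a b v x r lam ⊆ Metric.closedBall 0 (lam * rQ (a ⟨0, hn⟩) (b ⟨0, hn⟩) x r) := by
  intro w hw
  rw [mem_closedBall_zero_iff]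
  exact (hw _).2

lemma KK_fin (hn : 1 ≤ n) (a b v : Fin n → EuclideanSpace ℝ (Fin d))
    (x : EuclideanSpace ℝ (Fin d)) (r lam : ℝ) : volume (KK a b v x r lam) ≠ ⊤ :=
  ((measure_mono (KK_sub_ball hn a b v x r lam)).trans_lt measure_closedBall_lt_top).ne

lemma KK_pos (hn : 1 ≤ n) (a b v : Fin n → EuclideanSpace ℝ (Fin d)) (hv : ∀ i, ‖v i‖ = 1)
    (x : EuclideanSpace ℝ (Fin d)) (r lam : ℝ) (hr : 0 < r) (hl : 0 < lam) :
    0 < volume.real (KK a b v x r lam) := by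
  refine ENNReal.toReal_pos (ne_of_gt ?_) (KK_fin hn a b v x r lam)
  refine (Metric.measure_ball_pos volume 0 (mul_pos hl hr)).trans_le (measure_mono ?_)
  intro w hw i
  rw [mem_ball_zero_iff] at hw
  have h1 : r ≤ rR (a i) (b i) x r := le_max_left _ _
  have h2 : r ≤ rQ (a i) (b i) x r := le_max_left _ _
  exact ⟨(norm_prj_le _ _ (hv i)).trans (hw.le.trans (mul_le_mul_of_nonneg_left h1 hl.le)),
    hw.le.trans (mul_le_mul_of_nonneg_left h2 hl.le)⟩

lemma KK_mono_lam (a b v : Fin n → EuclideanSpace ℝ (Fin d)) 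
    (x : EuclideanSpace ℝ (Fin d)) (r l1 l2 : ℝ) (hr : 0 < r) (h : l1 ≤ l2) :
    KK a b v x r l1 ⊆ KK a b v x r l2 := by
  intro w hw i
  have h1 : r ≤ rR (a i) (b i) x r := le_max_left _ _
  have h2 : r ≤ rQ (a i) (b i) x r := le_max_left _ _
  have := hw i
  exact ⟨this.1.trans (mul_le_mul_of_nonneg_right h (by linarith)),
    this.2.trans (mul_le_mul_of_nonneg_right h (by linarith))⟩

lemma KK_mono_r (a b v : Fin n → EuclideanSpace ℝ (Fin d)) 
    (x : EuclideanSpace ℝ (Fin d)) (r r' l : ℝ) (hl : 0 < l) (h : r ≤ r') :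
    KK a b v x r l ⊆ KK a b v x r' l := by
  intro w hw i
  have := hw i
  exact ⟨this.1.trans (mul_le_mul_of_nonneg_left (max_le_max_right _ h) hl.le),
    this.2.trans (mul_le_mul_of_nonneg_left (max_le_max_right _ h) hl.le)⟩

lemma max_beta {r m beta : ℝ} (hm : 0 ≤ m) (hb : 1 ≤ beta) :
    max (beta * r) m ≤ beta * max r m := by
  apply max_le
  · exact mul_le_mul_of_nonneg_left (le_max_left _ _) (by linarith)
  · have := le_max_right r m
    nlinarith

lemma KK_beta (a b v : Fin n → EuclideanSpace ℝ (Fin d)) 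
    (x : EuclideanSpace ℝ (Fin d)) (r l beta : ℝ) (hl : 0 < l) (hb : 1 ≤ beta) :
    KK a b v x (beta * r) l ⊆ KK a b v x r (beta * l) := by
  intro w hw i
  have := hw i
  have h1 : rR (a i) (b i) x (beta * r) ≤ beta * rR (a i) (b i) x r :=
    max_beta Metric.infDist_nonneg hb
  have h2 : rQ (a i) (b i) x (beta * r) ≤ beta * rQ (a i) (b i) x r :=
    max_beta (le_min dist_nonneg dist_nonneg) hb
  constructor
  · nlinarith [mul_le_mul_of_nonneg_left h1 hl.le]
  · nlinarith [mul_le_mul_of_nonneg_left h2 hl.le]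

lemma expand (a b v : Fin n → EuclideanSpace ℝ (Fin d)) (hab : ∀ i, a i ≠ b i)
    (hv : ∀ i, ‖v i‖ = 1) (hdir : ∀ i, b i - a i = ‖b i - a i‖ • v i)
    (x y p z : EuclideanSpace ℝ (Fin d)) (r lam : ℝ) (hr : 0 < r) (h0 : 0 < lam) (h1 : lam < 1)
    (hpx : p - x ∈ KK a b v x r lam) (hpy : p - y ∈ KK a b v y r lam)
    (hz : z - y ∈ KK a b v y r lam) :
    z - x ∈ KK a b v x r ((3 + lam) / (1 - lam) * lam) := by
  intro i
  have hL : 0 < ‖b i - a i‖ := norm_pos_iff.2 (sub_ne_zero.2 (hab i).symm)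
  have hR := R_compare hL (hv i) (hdir i) x y p r lam hr h0 h1 (hpx i).1 (hpx i).2
    (hpy i).1 (hpy i).2
  have hQ := Q_compare (a i) (b i) x y p r lam (hpx i).2 (hpy i).2
  have key : ∀ X Y : ℝ, (1 - lam) * Y ≤ (1 + lam) * X →
      lam * Y + (lam * Y + lam * X) ≤ (3 + lam) / (1 - lam) * lam * X := by
    intro X Y h
    have hp : 0 < 1 - lam := by linarith
    rw [div_mul_eq_mul_div, div_mul_eq_mul_div, le_div_iff₀ hp]
    nlinarith [mul_le_mul_of_nonneg_left h h0.le]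
  have e : z - x = (z - y) + ((-1 : ℝ) • (p - y) + (p - x)) := by rw [neg_one_smul]; abel
  constructor
  · refine le_trans ?_ (key _ _ hR)
    rw [e, prj_add, prj_add, prj_smul]
    refine (norm_add_le _ _).trans (add_le_add (hz i).1 ((norm_add_le _ _).trans
      (add_le_add ?_ (hpx i).1)))
    rw [norm_smul, norm_neg, norm_one, one_mul]
    exact (hpy i).1
  · refine le_trans ?_ (key _ _ hQ)
    rw [e]
    refine (norm_add_le _ _).trans (add_le_add (hz i).2 ((norm_add_le _ _).trans
      (add_le_add ?_ (hpx i).2)))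
    rw [norm_smul, norm_neg, norm_one, one_mul]
    exact (hpy i).2

/-- **Packing bound.** If the capsules `C^{λ_p}(y, r)`, `y ∈ Y`,
are pairwise disjoint, then for any `x` and `β ≥ 1`, the set of `y ∈ Y` whose
capsule `C^{λ_c}(y, r)` meets `C^{λ_c}(x, βr)` is finite with cardinality at
most `(α²·λ_c·β/λ_p)ᵈ`, where `α = (3+λ_c)/(1-λ_c)`. -/
theorem capsule_packing_bound {d n : ℕ} (hd : 1 ≤ d) (hn : 1 ≤ n)
    (a b v : Fin n → EuclideanSpace ℝ (Fin d))
    (hab : ∀ i, a i ≠ b i)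
    (hv : ∀ i, ‖v i‖ = 1)
    (hdir : ∀ i, b i - a i = ‖b i - a i‖ • v i)
    (hdisj : ∀ i j, i ≠ j → Disjoint (segment ℝ (a i) (b i)) (segment ℝ (a j) (b j)))
    (r : ℝ) (hr : 0 < r)
    (lamp lamc : ℝ) (h0 : 0 < lamp) (hpc : lamp < lamc) (hc1 : lamc < 1)
    (Y : Set (EuclideanSpace ℝ (Fin d)))
    (hY : ∀ y ∈ Y, ∀ z ∈ Y, y ≠ z →
      Disjoint (scaleAbout y lamp (capsuleFam a b v y r))
               (scaleAbout z lamp (capsuleFam a b v z r)))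
    (x : EuclideanSpace ℝ (Fin d)) (beta : ℝ) (hbeta : 1 ≤ beta) :
    {y ∈ Y | (scaleAbout y lamc (capsuleFam a b v y r) ∩
        scaleAbout x lamc (capsuleFam a b v x (beta * r))).Nonempty}.Finite ∧
    ({y ∈ Y | (scaleAbout y lamc (capsuleFam a b v y r) ∩
        scaleAbout x lamc (capsuleFam a b v x (beta * r))).Nonempty}.ncard : ℝ) ≤
      (((3 + lamc) / (1 - lamc)) ^ 2 * lamc * beta / lamp) ^ d := by
  have hc0 : 0 < lamc := h0.trans hpc
  have hbr : 0 < beta * r := by positivity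
  have hrb : r ≤ beta * r := by nlinarith
  have ha : 0 < (3 + lamc) / (1 - lamc) := div_pos (by linarith) (by linarith)
  generalize hα : (3 + lamc) / (1 - lamc) = α at *
  set N := {y ∈ Y | (scaleAbout y lamc (capsuleFam a b v y r) ∩
        scaleAbout x lamc (capsuleFam a b v x (beta * r))).Nonempty} with hN
  set V := volume.real (KK a b v x (beta * r) lamc) with hV
  have hVpos : 0 < V := KK_pos hn a b v hv x _ _ hbr hc0
  have tr : ∀ (y : EuclideanSpace ℝ (Fin d)) (K : Set (EuclideanSpace ℝ (Fin d))),
      volume ((fun p => p - y) ⁻¹' K) = volume K := by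
    intro y K
    simp only [sub_eq_add_neg]
    exact measure_preimage_add_right volume (-y) K
  -- facts about each y
  have fact : ∀ y ∈ N, ∃ p, p - x ∈ KK a b v x (beta * r) lamc ∧
      p - y ∈ KK a b v y (beta * r) lamc := by
    rintro y ⟨-, p, hp1, hp2⟩
    rw [mem_scale a b v hv _ _ _ _ hc0] at hp1 hp2
    exact ⟨p, hp2, KK_mono_r _ _ _ _ _ _ _ hc0 hrb hp1⟩
  have sub1 : ∀ y ∈ N, (fun p => p - y) ⁻¹' KK a b v y r lamp ⊆
      (fun p => p - x) ⁻¹' KK a b v x (beta * r) (α * lamc) := by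
    intro y hy z hz
    obtain ⟨p, hpx, hpy⟩ := fact y hy
    have := expand a b v hab hv hdir x y p z _ _ hbr hc0 hc1 hpx hpy
      (KK_mono_r _ _ _ _ _ _ _ hc0 hrb (KK_mono_lam _ _ _ _ _ _ _ hr hpc.le hz))
    rw [hα] at this
    exact this
  have low : ∀ y ∈ N, V ≤ (α * beta * lamc / lamp) ^ d * volume.real (KK a b v y r lamp) := by
    intro y hy
    obtain ⟨p, hpx, hpy⟩ := fact y hy
    rw [← KK_vol_smul _ _ _ _ _ _ _ (by positivity)]
    have e : α * beta * lamc / lamp * lamp = beta * (α * lamc) := by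
      field_simp
    rw [e, hV, Measure.real, Measure.real, ← tr x, ← tr y (KK a b v y r _)]
    apply ENNReal.toReal_mono
    · rw [tr]; exact KK_fin hn _ _ _ _ _ _
    · apply measure_mono
      intro z hz
      have h5 := expand a b v hab hv hdir y x p z _ _ hbr hc0 hc1 hpy hpx hz
      rw [hα] at h5
      have h6 : 0 < α * lamc := mul_pos ha hc0
      have h7 := KK_beta a b v y r (α * lamc) beta h6 hbeta h5
      exact h7
  have main : ∀ T : Finset (EuclideanSpace ℝ (Fin d)), (T : Set _) ⊆ N →
      (T.card : ℝ) ≤ (α ^ 2 * lamc * beta / lamp) ^ d := by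
    intro T hT
    have hdis : (T : Set (EuclideanSpace ℝ (Fin d))).PairwiseDisjoint
        (fun y => (fun p => p - y) ⁻¹' KK a b v y r lamp) := by
      intro y hy z hz hyz
      have := hY y (hT hy).1 z (hT hz).1 hyz
      have e : ∀ y, scaleAbout y lamp (capsuleFam a b v y r) =
          (fun p => p - y) ⁻¹' KK a b v y r lamp := by
        intro y; ext p; exact mem_scale a b v hv y p r lamp h0
      rw [e, e] at this
      exact this
    have hsum : ∑ y ∈ T, volume.real (KK a b v y r lamp) ≤ α ^ d * V := by
      rw [hV, ← KK_vol_smul _ _ _ _ _ _ _ ha]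
      have h1 := measureReal_biUnion_finset (μ := volume) hdis
        (fun y _ => ((KK_closed a b v y r lamp).preimage
          (continuous_id.sub continuous_const)).measurableSet)
        (fun y _ => by rw [tr]; exact KK_fin hn _ _ _ _ _ _)
      have h2 : ∀ y, volume.real ((fun p => p - y) ⁻¹' KK a b v y r lamp) =
          volume.real (KK a b v y r lamp) := fun y => by rw [Measure.real, tr, Measure.real]
      simp only [h2] at h1
      rw [← h1]
      rw [Measure.real, Measure.real, ← tr x (KK a b v x (beta * r) (α * lamc))]
      apply ENNReal.toReal_mono
      · rw [tr]; exact KK_fin hn _ _ _ _ _ _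
      · apply measure_mono
        exact Set.iUnion₂_subset fun y hy => sub1 y (hT hy)
    have hcV : (T.card : ℝ) * V ≤ (α ^ 2 * lamc * beta / lamp) ^ d * V := by
      calc (T.card : ℝ) * V = ∑ y ∈ T, V := by simp
        _ ≤ ∑ y ∈ T, (α * beta * lamc / lamp) ^ d * volume.real (KK a b v y r lamp) :=
          Finset.sum_le_sum fun y hy => low y (hT hy)
        _ = (α * beta * lamc / lamp) ^ d * ∑ y ∈ T, volume.real (KK a b v y r lamp) := by
          rw [Finset.mul_sum]
        _ ≤ (α * beta * lamc / lamp) ^ d * (α ^ d * V) :=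
          mul_le_mul_of_nonneg_left hsum (by positivity)
        _ = (α ^ 2 * lamc * beta / lamp) ^ d * V := by
          rw [← mul_assoc, ← mul_pow]; congr 2; ring
    exact le_of_mul_le_mul_right hcV hVpos
  have hfin : N.Finite := by
    by_contra hinf
    obtain ⟨k, hk⟩ := exists_nat_gt ((α ^ 2 * lamc * beta / lamp) ^ d)
    obtain ⟨T, hT, hcard⟩ := Set.Infinite.exists_subset_card_eq hinf k
    have := main T hT
    rw [hcard] at this
    linarith
  refine ⟨hfin, ?_⟩
  have hm := main hfin.toFinset (fun y hy => hfin.mem_toFinset.1 hy)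
  rw [Set.ncard_eq_toFinset_card N hfin]
  exact hm
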